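/- Let M be an endotrivial V(a_2)-supermodule in F, where a_2 is a rank 2 detecting subalgebra. Then M ≅ Ω^n(k) ⊕ P for some integer n, where k is either the trivial module k_ev or its parity shift k_od, and P is a projective module in F. -/

import Mathlib

/-!
A concrete model of the supermodule categories of the paper "On Endotrivial
Modules for Lie Superalgebras" attached to the detecting subalgebras
`e_r = q(1)^{×r}`, `f_n = sl(1|1)^{×n}`, to rank-one subalgebras `⟨z⟩` of
`sl(1|1)`, and to the exterior superalgebras `V(a_r) = Λ((a_r)₁)`.

A `GSupMod k ι` is a finite-dimensional `ℤ₂`-graded `k`-vector space together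
with a family of odd operators `θ i` (the actions of the distinguished odd
basis elements of the superalgebra: the `e_i` for `e_r`, the `x_i, y_i` for
`f_n`, the `a_i` for `V(a_r)`).  The even parts of all these superalgebras are
generated by the brackets of the odd generators, so the relations defining
each particular category, as well as complete reducibility over the even part,
are imposed by a predicate `𝒞 : GSupMod k ι → Prop`, defined separately for
each case.  All categorical notions (homomorphisms, isomorphisms, direct sums,
tensor products, duals, internal Hom, trivial modules, projectivity,
projective covers and injective hulls, syzygies `Ωⁿ` for `n : ℤ`, endotrivial
modules, and the group `T` of stable classes of endotrivial modules) are
defined relative to such a predicate.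
-/

noncomputable section

namespace SupCat

open Submodule

/-- A finite-dimensional `ℤ₂`-graded `k`-vector space with a family of odd
operators `θ i`, indexed by `ι` (the underlying data of a supermodule over a
superalgebra whose odd part has a distinguished basis indexed by `ι`). -/
structure GSupMod (k : Type) [Field k] (ι : Type) : Type 1 where
  carrier : Type
  [isAddCommGroup : AddCommGroup carrier]
  [isModule : Module k carrier]
  [isFinite : FiniteDimensional k carrier]
  /-- the even component -/
  ev : Submodule k carrier
  /-- the odd component -/
  od : Submodule k carrier
  isCompl : IsCompl ev od
  /-- the (odd) actions of the distinguished odd basis elements -/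
  θ : ι → (carrier →ₗ[k] carrier)
  θ_ev : ∀ i, ∀ m ∈ ev, θ i m ∈ od
  θ_od : ∀ i, ∀ m ∈ od, θ i m ∈ ev

attribute [instance] GSupMod.isAddCommGroup GSupMod.isModule GSupMod.isFinite

namespace GSupMod

variable {k : Type} [Field k] {ι : Type}

/-- The action of a general odd element `v = ∑ v i • (basis element i)`. -/
def actOf [Fintype ι] (M : GSupMod k ι) (v : ι → k) : M.carrier →ₗ[k] M.carrier :=
  ∑ i, v i • M.θ i

/-- The grading involution `σ` of a supermodule: `+1` on the even part and
`-1` on the odd part. -/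
def sigma (M : GSupMod k ι) : M.carrier →ₗ[k] M.carrier :=
  M.ev.subtype ∘ₗ Submodule.linearProjOfIsCompl M.ev M.od M.isCompl
    - M.od.subtype ∘ₗ Submodule.linearProjOfIsCompl M.od M.ev M.isCompl.symm

/-- `f` is a homomorphism of supermodules (an equivariant linear map of
degree `0̄`). -/
def IsHom (M N : GSupMod k ι) (f : M.carrier →ₗ[k] N.carrier) : Prop :=
  (∀ i, f ∘ₗ M.θ i = N.θ i ∘ₗ f) ∧
  (∀ m ∈ M.ev, f m ∈ N.ev) ∧ (∀ m ∈ M.od, f m ∈ N.od)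

/-- `M ≅ N` as supermodules. -/
def Iso (M N : GSupMod k ι) : Prop :=
  ∃ e : M.carrier ≃ₗ[k] N.carrier, IsHom M N (e : M.carrier →ₗ[k] N.carrier)

/-- `S` is (isomorphic to) the direct sum `A ⊕ B`. -/
def IsDsum (A B S : GSupMod k ι) : Prop :=
  ∃ φ : S.carrier ≃ₗ[k] A.carrier × B.carrier,
    (∀ s, s ∈ S.ev ↔ (φ s).1 ∈ A.ev ∧ (φ s).2 ∈ B.ev) ∧
    (∀ s, s ∈ S.od ↔ (φ s).1 ∈ A.od ∧ (φ s).2 ∈ B.od) ∧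
    ∀ (i : ι) (s : S.carrier),
      φ (S.θ i s) = LinearMap.prodMap (A.θ i) (B.θ i) (φ s)

/-- `M` is (isomorphic to) the trivial supermodule of parity `p`: `k_ev`
for `p = false`, and `k_od = Π(k_ev)` for `p = true`. -/
def IsTrivial (p : Bool) (M : GSupMod k ι) : Prop :=
  Module.finrank k M.carrier = 1 ∧ (∀ i, M.θ i = 0) ∧
    (if p then M.od = ⊤ else M.ev = ⊤)

/-- `M` is indecomposable. -/
def Indecomposable (M : GSupMod k ι) : Prop :=
  (∃ m : M.carrier, m ≠ 0) ∧
  ∀ A B : GSupMod k ι, IsDsum A B M →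
    (∀ a : A.carrier, a = 0) ∨ (∀ b : B.carrier, b = 0)

/-- `M` is a simple supermodule: nonzero, with no proper nonzero graded
invariant submodule. -/
def IsSimple (M : GSupMod k ι) : Prop :=
  (∃ m : M.carrier, m ≠ 0) ∧
  ∀ N : Submodule k M.carrier,
    (∀ i, ∀ m ∈ N, M.θ i m ∈ N) →
    N = (N ⊓ M.ev) ⊔ (N ⊓ M.od) →
    N = ⊥ ∨ N = ⊤

variable (𝒞 : GSupMod k ι → Prop)

/-- `P` is a projective object of the category cut out by `𝒞` (defined by the
lifting property). -/
def IsProjective (P : GSupMod k ι) : Prop :=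
  𝒞 P ∧
  ∀ (M N : GSupMod k ι) (π : M.carrier →ₗ[k] N.carrier)
    (f : P.carrier →ₗ[k] N.carrier),
    𝒞 M → 𝒞 N → IsHom M N π → Function.Surjective π → IsHom P N f →
    ∃ h : P.carrier →ₗ[k] M.carrier, IsHom P M h ∧ π ∘ₗ h = f

/-- `I` is an injective object of the category cut out by `𝒞`. -/
def IsInjective (I : GSupMod k ι) : Prop :=
  𝒞 I ∧
  ∀ (M N : GSupMod k ι) (j : M.carrier →ₗ[k] N.carrier)
    (f : M.carrier →ₗ[k] I.carrier),
    𝒞 M → 𝒞 N → IsHom M N j → Function.Injective j → IsHom M I f →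
    ∃ h : N.carrier →ₗ[k] I.carrier, IsHom N I h ∧ h ∘ₗ j = f

/-- `π : P ↠ M` is a projective cover. -/
def IsProjCover (P M : GSupMod k ι) (π : P.carrier →ₗ[k] M.carrier) : Prop :=
  IsProjective 𝒞 P ∧ IsHom P M π ∧ Function.Surjective π ∧
  ∀ (Q : GSupMod k ι) (f : Q.carrier →ₗ[k] P.carrier),
    𝒞 Q → IsHom Q P f → Function.Surjective (π ∘ₗ f) → Function.Surjective f

/-- `j : M ↪ I` is an injective hull. -/
def IsInjHull (M I : GSupMod k ι) (j : M.carrier →ₗ[k] I.carrier) : Prop :=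
  IsInjective 𝒞 I ∧ IsHom M I j ∧ Function.Injective j ∧
  ∀ (Q : GSupMod k ι) (f : I.carrier →ₗ[k] Q.carrier),
    𝒞 Q → IsHom I Q f → Function.Injective (f ∘ₗ j) → Function.Injective f

/-- `N` is (isomorphic to) the first syzygy `Ω¹(M)`, the kernel of a
projective cover of `M`. -/
def IsSyzygy (M N : GSupMod k ι) : Prop :=
  𝒞 N ∧
  ∃ (P : GSupMod k ι) (π : P.carrier →ₗ[k] M.carrier)
    (i : N.carrier →ₗ[k] P.carrier),
    IsProjCover 𝒞 P M π ∧ IsHom N P i ∧ Function.Injective i ∧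
    LinearMap.range i = LinearMap.ker π

/-- `N` is (isomorphic to) the first cosyzygy `Ω⁻¹(M)`, the cokernel of the
inclusion of `M` into its injective hull. -/
def IsCosyzygy (M N : GSupMod k ι) : Prop :=
  𝒞 N ∧
  ∃ (I : GSupMod k ι) (j : M.carrier →ₗ[k] I.carrier)
    (p : I.carrier →ₗ[k] N.carrier),
    IsInjHull 𝒞 M I j ∧ IsHom I N p ∧ Function.Surjective p ∧
    LinearMap.ker p = LinearMap.range j

/-- `M` has no nonzero projective direct summand (equivalently, since the
category is self-injective, no nonzero projective submodule). -/
def NoProjSummands (M : GSupMod k ι) : Prop :=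
  ∀ A B : GSupMod k ι, IsProjective 𝒞 A → IsDsum A B M → ∀ a : A.carrier, a = 0

/-- `N` is (isomorphic to) `Ω⁰(M)`, the complement of the largest projective
direct summand of `M`. -/
def IsOmegaZero (M N : GSupMod k ι) : Prop :=
  ∃ Q : GSupMod k ι, IsProjective 𝒞 Q ∧ NoProjSummands 𝒞 N ∧ IsDsum N Q M

/-- `N` is (isomorphic to) `Ωⁿ(M)` for `n ∈ ℕ`. -/
def IsOmegaPow : ℕ → GSupMod k ι → GSupMod k ι → Prop
  | 0, M, N => IsOmegaZero 𝒞 M N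
  | n+1, M, N => ∃ L, IsOmegaPow n M L ∧ IsSyzygy 𝒞 L N

/-- `N` is (isomorphic to) `Ω⁻ⁿ(M)` for `n ∈ ℕ`. -/
def IsOmegaNegPow : ℕ → GSupMod k ι → GSupMod k ι → Prop
  | 0, M, N => IsOmegaZero 𝒞 M N
  | n+1, M, N => ∃ L, IsOmegaNegPow n M L ∧ IsCosyzygy 𝒞 L N

/-- `N` is (isomorphic to) the syzygy `Ωⁿ(M)`, for any `n : ℤ`. -/
def IsOmega (n : ℤ) (M N : GSupMod k ι) : Prop :=
  if 0 ≤ n then IsOmegaPow 𝒞 n.toNat M N else IsOmegaNegPow 𝒞 (-n).toNat M N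

/-- `H` is (isomorphic to) the internal Hom supermodule `Hom_k(M,N)` with its
usual grading and the super action of the odd generators
`(θ i · f)(m) = θ i (f m) - (-1)^{|f|} f (θ i m)` (the sign `(-1)^{|f|}` is
expressed via the grading involutions `σ`). -/
def IsHomObj (M N H : GSupMod k ι) : Prop :=
  ∃ φ : H.carrier ≃ₗ[k] (M.carrier →ₗ[k] N.carrier),
    (∀ h, h ∈ H.ev ↔ ((∀ m ∈ M.ev, φ h m ∈ N.ev) ∧ (∀ m ∈ M.od, φ h m ∈ N.od))) ∧
    (∀ h, h ∈ H.od ↔ ((∀ m ∈ M.ev, φ h m ∈ N.od) ∧ (∀ m ∈ M.od, φ h m ∈ N.ev))) ∧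
    ∀ (i : ι) (h : H.carrier),
      φ (H.θ i h) = N.θ i ∘ₗ φ h - (N.sigma ∘ₗ φ h ∘ₗ M.sigma) ∘ₗ M.θ i

/-- `T` is (isomorphic to) the tensor product supermodule `M ⊗_k N` with its
usual grading and the action of the odd generators
`θ i · (m ⊗ n) = (θ i m) ⊗ n + (-1)^{|m|} m ⊗ (θ i n)`. -/
def IsTensorObj (M N T : GSupMod k ι) : Prop :=
  ∃ φ : T.carrier ≃ₗ[k] TensorProduct k M.carrier N.carrier,
    Submodule.map (φ : T.carrier →ₗ[k] TensorProduct k M.carrier N.carrier) T.ev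
      = Submodule.span k
          ({z | ∃ m ∈ M.ev, ∃ n ∈ N.ev, z = m ⊗ₜ[k] n}
            ∪ {z | ∃ m ∈ M.od, ∃ n ∈ N.od, z = m ⊗ₜ[k] n}) ∧
    Submodule.map (φ : T.carrier →ₗ[k] TensorProduct k M.carrier N.carrier) T.od
      = Submodule.span k
          ({z | ∃ m ∈ M.ev, ∃ n ∈ N.od, z = m ⊗ₜ[k] n}
            ∪ {z | ∃ m ∈ M.od, ∃ n ∈ N.ev, z = m ⊗ₜ[k] n}) ∧
    ∀ (i : ι) (t : T.carrier),
      φ (T.θ i t)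
        = TensorProduct.map (M.θ i) (LinearMap.id : N.carrier →ₗ[k] N.carrier) (φ t)
            + TensorProduct.map M.sigma (N.θ i) (φ t)

/-- `D` is (isomorphic to) the dual supermodule `M* = Hom_k(M, k_ev)`, with
the action `(θ i · ψ)(m) = -(-1)^{|ψ|} ψ (θ i m)`. -/
def IsDualObj (M D : GSupMod k ι) : Prop :=
  ∃ φ : D.carrier ≃ₗ[k] Module.Dual k M.carrier,
    (∀ d, d ∈ D.ev ↔ ∀ m ∈ M.od, φ d m = 0) ∧
    (∀ d, d ∈ D.od ↔ ∀ m ∈ M.ev, φ d m = 0) ∧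
    ∀ (i : ι) (d : D.carrier),
      φ (D.θ i d) = - (φ d) ∘ₗ (M.sigma ∘ₗ M.θ i)

/-- `M` is an endotrivial supermodule of the category cut out by `𝒞`:
`Hom_k(M,M) ≅ k_ev ⊕ P` with `P` projective. -/
def IsEndotrivial (M : GSupMod k ι) : Prop :=
  𝒞 M ∧
  ∃ H K P S : GSupMod k ι, IsHomObj M M H ∧ 𝒞 H ∧ IsTrivial false K ∧
    IsProjective 𝒞 P ∧ IsDsum K P S ∧ Iso H S

/-- `M` and `N` are isomorphic in the stable module category: they become
isomorphic after adding projective direct summands. -/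
def StIso (M N : GSupMod k ι) : Prop :=
  ∃ P Q S T : GSupMod k ι, IsProjective 𝒞 P ∧ IsProjective 𝒞 Q ∧
    IsDsum M P S ∧ IsDsum N Q T ∧ Iso S T

/-- `R` is (isomorphic to) the restriction of `M` along the subalgebra of the
odd space spanned by the vectors `ε j`: the same underlying graded vector
space, where the `j`-th odd generator acts as the element `ε j` did on `M`. -/
def IsRestriction {ι' : Type} [Fintype ι] (ε : ι' → ι → k)
    (M : GSupMod k ι) (R : GSupMod k ι') : Prop :=
  ∃ φ : R.carrier ≃ₗ[k] M.carrier,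
    (∀ m, m ∈ R.ev ↔ φ m ∈ M.ev) ∧
    (∀ m, m ∈ R.od ↔ φ m ∈ M.od) ∧
    ∀ (j : ι') (m : R.carrier), φ (R.θ j m) = actOf M (ε j) (φ m)

/-- The radical `Rad(M)` of a supermodule over one of the detecting
superalgebras on the principal block: the span of the images of the odd
generators. -/
def radical (M : GSupMod k ι) : Submodule k M.carrier :=
  ⨆ i, LinearMap.range (M.θ i)

/-- The rank `Rk(M) = dim_k (M / Rad M)`. -/
def rk (M : GSupMod k ι) : ℕ :=
  Module.finrank k (M.carrier ⧸ radical M)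

end GSupMod

open GSupMod

variable {k : Type} [Field k]

/-- The category of supermodules (in the principal block) over the exterior
superalgebra `V(a_r) = Λ((a_r)₁)` on the purely odd abelian `r`-dimensional
space `(a_r)₁`: the odd generators pairwise super-anticommute (in particular
they square to zero).  Complete reducibility over the even part is automatic
since the even part acts by zero. -/
def VCat (k : Type) [Field k] (r : ℕ) : GSupMod k (Fin r) → Prop :=
  fun M => ∀ i j, M.θ i ∘ₗ M.θ j + M.θ j ∘ₗ M.θ i = 0

/-- The relation on endotrivial supermodules inducing the group `T`: stable
isomorphism. -/
def TRel {ι : Type} (𝒞 : GSupMod k ι → Prop) :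
    {M : GSupMod k ι // IsEndotrivial 𝒞 M} →
    {M : GSupMod k ι // IsEndotrivial 𝒞 M} → Prop :=
  fun M N => StIso 𝒞 M.1 N.1

/-- The underlying set of the group `T`: stable isomorphism classes of
endotrivial supermodules. -/
def TGrp {ι : Type} (𝒞 : GSupMod k ι → Prop) : Type 1 := Quot (TRel 𝒞)

/-- The stable class of an endotrivial supermodule. -/
def tmk {ι : Type} (𝒞 : GSupMod k ι → Prop)
    (M : {M : GSupMod k ι // IsEndotrivial 𝒞 M}) : TGrp 𝒞 :=
  Quot.mk (TRel 𝒞) M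

/-- An abelian group structure on `T` whose multiplication, identity and
inverse are induced by tensor product, the trivial module `k_ev` and duality
respectively. -/
structure TGroupData {ι : Type} (𝒞 : GSupMod k ι → Prop) : Type 1 where
  mul : TGrp 𝒞 → TGrp 𝒞 → TGrp 𝒞
  one : TGrp 𝒞
  inv : TGrp 𝒞 → TGrp 𝒞
  mul_assoc : ∀ a b c, mul (mul a b) c = mul a (mul b c)
  mul_comm : ∀ a b, mul a b = mul b a
  one_mul : ∀ a, mul one a = a
  inv_mul : ∀ a, mul (inv a) a = one
  mul_spec : ∀ (M N : {M : GSupMod k ι // IsEndotrivial 𝒞 M}) (T : GSupMod k ι)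
      (_ : IsTensorObj M.1 N.1 T) (hT : IsEndotrivial 𝒞 T),
      mul (tmk 𝒞 M) (tmk 𝒞 N) = tmk 𝒞 ⟨T, hT⟩
  one_spec : ∀ (K : GSupMod k ι) (_ : IsTrivial false K) (hK : IsEndotrivial 𝒞 K),
      one = tmk 𝒞 ⟨K, hK⟩
  inv_spec : ∀ (M : {M : GSupMod k ι // IsEndotrivial 𝒞 M}) (D : GSupMod k ι)
      (_ : IsDualObj M.1 D) (hD : IsEndotrivial 𝒞 D),
      inv (tmk 𝒞 M) = tmk 𝒞 ⟨D, hD⟩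

end SupCat

namespace SupCat

open Submodule GSupMod

namespace Aux

variable {k : Type} [Field k]

/-- projection to the even part -/
def pr (M : GSupMod k (Fin 2)) : M.carrier →ₗ[k] M.carrier :=
  M.ev.subtype ∘ₗ Submodule.projectionOnto M.ev M.od M.isCompl

theorem mem_ev (M : GSupMod k (Fin 2)) (m : M.carrier) : m ∈ M.ev ↔ pr M m = m := by
  constructor
  · intro h
    have := Submodule.projectionOnto_apply_left M.isCompl ⟨m, h⟩
    simp [pr, this]
  · intro h
    rw [← h]
    simp [pr]

theorem mem_od (M : GSupMod k (Fin 2)) (m : M.carrier) : m ∈ M.od ↔ pr M m = 0 := by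
  simp [pr]

theorem pr_pr (M : GSupMod k (Fin 2)) (m : M.carrier) : pr M (pr M m) = pr M m := by
  rw [← mem_ev]; simp [pr]

theorem θ_pr (M : GSupMod k (Fin 2)) (i : Fin 2) (m : M.carrier) :
    M.θ i (pr M m) = M.θ i m - pr M (M.θ i m) := by
  have h1 : pr M (M.θ i (pr M m)) = 0 := by
    rw [← mem_od]
    exact M.θ_ev i _ ((mem_ev M _).2 (pr_pr M m))
  have h2 : pr M (M.θ i (m - pr M m)) = M.θ i (m - pr M m) := by
    rw [← mem_ev]
    exact M.θ_od i _ ((mem_od M _).2 (by simp [pr_pr]))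
  simp only [map_sub, h1, sub_zero] at h2
  rw [h2]; abel

theorem pr_θ (M : GSupMod k (Fin 2)) (i : Fin 2) (m : M.carrier) :
    pr M (M.θ i m) = M.θ i m - M.θ i (pr M m) := by
  rw [θ_pr]; abel

theorem sigma_apply (M : GSupMod k (Fin 2)) (m : M.carrier) :
    M.sigma m = pr M m - (m - pr M m) := by
  have : (Submodule.projectionOnto M.od M.ev M.isCompl.symm m : M.carrier)
      = m - pr M m := by
    have h1 : pr M m ∈ M.ev := (mem_ev M _).2 (pr_pr M m)
    have h2 : m - pr M m ∈ M.od := (mem_od M _).2 (by simp [pr_pr])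
    have e1 : Submodule.projectionOnto M.od M.ev M.isCompl.symm (pr M m) = 0 := by
      simpa using h1
    have e2 := Submodule.projectionOnto_apply_left M.isCompl.symm ⟨m - pr M m, h2⟩
    simp only [map_sub, e1, sub_zero] at e2
    rw [e2]
  change pr M m - (Submodule.projectionOnto M.od M.ev M.isCompl.symm m : M.carrier) = _
  rw [this]

theorem isHom_iff (M N : GSupMod k (Fin 2)) (f : M.carrier →ₗ[k] N.carrier) :
    IsHom M N f ↔ (∀ i m, f (M.θ i m) = N.θ i (f m)) ∧ ∀ m, f (pr M m) = pr N (f m) := by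
  constructor
  · rintro ⟨h1, h2, h3⟩
    refine ⟨fun i m => by simpa using LinearMap.congr_fun (h1 i) m, fun m => ?_⟩
    have e1 := (mem_ev N _).1 (h2 _ ((mem_ev M _).2 (pr_pr M m)))
    have e2 := (mem_od N _).1 (h3 (m - pr M m) ((mem_od M _).2 (by simp [pr_pr])))
    simp only [map_sub, e1] at e2
    exact (sub_eq_zero.1 e2).symm
  · rintro ⟨h1, h2⟩
    refine ⟨fun i => LinearMap.ext fun m => by simpa using h1 i m, fun m hm => ?_, fun m hm => ?_⟩
    · rw [mem_ev] at *; rw [← h2, hm]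
    · rw [mem_od] at *; rw [← h2, hm, map_zero]

/-- builder -/
@[reducible] def mkG (V : Type) [AddCommGroup V] [Module k V] [FiniteDimensional k V]
    (p : V →ₗ[k] V) (hp : ∀ m, p (p m) = p m) (θ : Fin 2 → (V →ₗ[k] V))
    (hθ : ∀ i m, θ i (p m) = θ i m - p (θ i m)) : GSupMod k (Fin 2) where
  carrier := V
  ev := LinearMap.ker (p - LinearMap.id)
  od := LinearMap.ker p
  isCompl := by
    constructor
    · rw [Submodule.disjoint_def]
      intro m h1 h2
      simp only [LinearMap.mem_ker, LinearMap.sub_apply, LinearMap.id_apply] at h1 h2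
      simpa [h2] using h1
    · rw [codisjoint_iff, eq_top_iff]
      intro m _
      refine Submodule.mem_sup.2 ⟨p m, ?_, m - p m, ?_, by abel⟩
      · simp [hp]
      · simp [hp]
  θ := θ
  θ_ev := by
    intro i m h
    simp only [LinearMap.mem_ker, LinearMap.sub_apply, LinearMap.id_apply] at h ⊢
    have := hθ i m
    rw [sub_eq_zero.1 h, eq_comm, sub_eq_self] at this
    exact this
  θ_od := by
    intro i m h
    simp only [LinearMap.mem_ker, LinearMap.sub_apply, LinearMap.id_apply] at h ⊢
    have := hθ i m
    rw [h, map_zero] at this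
    rw [← neg_sub, ← this, neg_zero]

theorem pr_mkG (V : Type) [AddCommGroup V] [Module k V] [FiniteDimensional k V]
    (p : V →ₗ[k] V) (hp : ∀ m, p (p m) = p m) (θ : Fin 2 → (V →ₗ[k] V))
    (hθ : ∀ i m, θ i (p m) = θ i m - p (θ i m)) : pr (mkG V p hp θ hθ) = p := by
  ext m
  have e1 : pr (mkG V p hp θ hθ) (p m) = p m := by
    rw [← mem_ev]
    change p m ∈ LinearMap.ker (p - LinearMap.id)
    simp [hp]
  have e2 : pr (mkG V p hp θ hθ) (m - p m) = 0 := by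
    rw [← mem_od]
    change m - p m ∈ LinearMap.ker p
    simp [hp]
  rw [map_sub, e1] at e2
  exact sub_eq_zero.1 e2

/-- The degree zero part of a linear map. -/
def avg (A M : GSupMod k (Fin 2)) (t : A.carrier →ₗ[k] M.carrier) : A.carrier →ₗ[k] M.carrier :=
  pr M ∘ₗ t ∘ₗ pr A + (LinearMap.id - pr M) ∘ₗ t ∘ₗ (LinearMap.id - pr A)

theorem avg_apply (A M : GSupMod k (Fin 2)) (t : A.carrier →ₗ[k] M.carrier) (a) :
    avg A M t a = pr M (t (pr A a)) + (t (a - pr A a) - pr M (t (a - pr A a))) := by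
  simp [avg]

theorem avg_pr (A M : GSupMod k (Fin 2)) (t : A.carrier →ₗ[k] M.carrier) (a) :
    avg A M t (pr A a) = pr M (avg A M t a) := by
  simp [avg_apply, pr_pr]

structure Rel (M : GSupMod k (Fin 2)) : Prop where
  xx : ∀ m, M.θ 0 (M.θ 0 m) = 0
  yy : ∀ m, M.θ 1 (M.θ 1 m) = 0
  yx : ∀ m, M.θ 1 (M.θ 0 m) = - M.θ 0 (M.θ 1 m)

theorem vcat_iff [CharZero k] (M : GSupMod k (Fin 2)) : VCat k 2 M ↔ Rel M := by
  constructor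
  · intro h
    have key : ∀ i j m, M.θ i (M.θ j m) + M.θ j (M.θ i m) = 0 := fun i j m => by
      simpa using LinearMap.congr_fun (h i j) m
    have sq : ∀ i m, M.θ i (M.θ i m) = 0 := fun i m => by
      have := key i i m
      rw [← two_smul k] at this
      exact (smul_eq_zero.1 this).resolve_left two_ne_zero
    exact ⟨sq 0, sq 1, fun m => eq_neg_of_add_eq_zero_left (key 1 0 m)⟩
  · rintro ⟨h1, h2, h3⟩ i j
    ext m
    fin_cases i <;> fin_cases j <;> simp [h1, h2, h3]

/-! free modules -/

section
variable {V : Type} [AddCommGroup V] [Module k V]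
open LinearMap in
def fx (k : Type) [Field k] (V : Type) [AddCommGroup V] [Module k V] :
    (V × V × V × V) →ₗ[k] (V × V × V × V) where
  toFun q := (0, q.1, 0, q.2.2.1)
  map_add' a b := by simp
  map_smul' a b := by simp

def fy (k : Type) [Field k] (V : Type) [AddCommGroup V] [Module k V] :
    (V × V × V × V) →ₗ[k] (V × V × V × V) where
  toFun q := (0, 0, q.1, - q.2.1)
  map_add' a b := by simp; abel
  map_smul' a b := by simp

def fp (p : V →ₗ[k] V) : (V × V × V × V) →ₗ[k] (V × V × V × V) where
  toFun q := (p q.1, q.2.1 - p q.2.1, q.2.2.1 - p q.2.2.1, p q.2.2.2)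
  map_add' a b := by simp; constructor <;> abel
  map_smul' a b := by simp [smul_sub]
end

/-- The free supermodule on a graded space. -/
def Fr (A : GSupMod k (Fin 2)) : GSupMod k (Fin 2) :=
  mkG (A.carrier × A.carrier × A.carrier × A.carrier) (fp (pr A))
    (by rintro ⟨a, b, c, d⟩; simp [fp, pr_pr])
    ![fx k A.carrier, fy k A.carrier]
    (by
      intro i
      fin_cases i
      · rintro ⟨a, b, c, d⟩; simp [fp, fx]
      · rintro ⟨a, b, c, d⟩; simp [fp, fy]; abel)

/-- elements of the free supermodule -/
def q4 (A : GSupMod k (Fin 2)) (a b c d : A.carrier) : (Fr A).carrier :=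
  ((a, b, c, d) : A.carrier × A.carrier × A.carrier × A.carrier)

section
variable (A : GSupMod k (Fin 2))

theorem q4_cases (q : (Fr A).carrier) : ∃ a b c d, q = q4 A a b c d :=
  ⟨Prod.fst (α := A.carrier) q, _, _, _, rfl⟩

theorem q4_inj (a b c d a' b' c' d' : A.carrier) :
    q4 A a b c d = q4 A a' b' c' d' ↔ a = a' ∧ b = b' ∧ c = c' ∧ d = d' := by
  simp only [q4]
  constructor
  · intro h
    have h' : ((a, b, c, d) : A.carrier × A.carrier × A.carrier × A.carrier) = (a', b', c', d') := h
    simpa using h'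
  · rintro ⟨rfl, rfl, rfl, rfl⟩; rfl

theorem q4_add (a b c d a' b' c' d' : A.carrier) :
    q4 A a b c d + q4 A a' b' c' d' = q4 A (a + a') (b + b') (c + c') (d + d') := rfl

theorem q4_sub (a b c d a' b' c' d' : A.carrier) :
    q4 A a b c d - q4 A a' b' c' d' = q4 A (a - a') (b - b') (c - c') (d - d') := rfl

theorem q4_neg (a b c d : A.carrier) :
    - q4 A a b c d = q4 A (-a) (-b) (-c) (-d) := rfl

theorem q4_smul (r : k) (a b c d : A.carrier) :
    r • q4 A a b c d = q4 A (r • a) (r • b) (r • c) (r • d) := rfl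

theorem q4_zero : (0 : (Fr A).carrier) = q4 A 0 0 0 0 := rfl

theorem Fr_x (a b c d : A.carrier) : (Fr A).θ 0 (q4 A a b c d) = q4 A 0 a 0 c := rfl

theorem Fr_y (a b c d : A.carrier) : (Fr A).θ 1 (q4 A a b c d) = q4 A 0 0 a (-b) := rfl

theorem Fr_p (a b c d : A.carrier) :
    pr (Fr A) (q4 A a b c d) = q4 A (pr A a) (b - pr A b) (c - pr A c) (pr A d) := by
  unfold Fr
  rw [pr_mkG]; rfl

theorem finrank_Fr : Module.finrank k (Fr A).carrier = 4 * Module.finrank k A.carrier := by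
  change Module.finrank k (A.carrier × A.carrier × A.carrier × A.carrier) = _
  simp only [Module.finrank_prod]; ring

/-- top component -/
def tp : (Fr A).carrier →ₗ[k] A.carrier :=
  LinearMap.fst k A.carrier (A.carrier × A.carrier × A.carrier)

theorem tp_q4 (a b c d : A.carrier) : tp A (q4 A a b c d) = a := rfl

/-- socle component -/
def so : (Fr A).carrier →ₗ[k] A.carrier :=
  LinearMap.snd k A.carrier A.carrier ∘ₗ LinearMap.snd k A.carrier (A.carrier × A.carrier) ∘ₗ
      LinearMap.snd k A.carrier (A.carrier × A.carrier × A.carrier)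

theorem so_q4 (a b c d : A.carrier) : so A (q4 A a b c d) = d := rfl

/-- inclusion of the top -/
def itp : A.carrier →ₗ[k] (Fr A).carrier :=
  LinearMap.inl k A.carrier (A.carrier × A.carrier × A.carrier)

theorem itp_apply (a : A.carrier) : itp A a = q4 A a 0 0 0 := rfl

/-- inclusion of the socle -/
def iso : A.carrier →ₗ[k] (Fr A).carrier where
  toFun d := q4 A 0 0 0 d
  map_add' a b := by simp [q4_add]
  map_smul' a b := by simp [q4_smul]

theorem iso_apply (a : A.carrier) : iso A a = q4 A 0 0 0 a := rfl

theorem rel_Fr : Rel (Fr A) := by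
  constructor <;> intro q <;> obtain ⟨a, b, c, d, rfl⟩ := q4_cases A q
  · simp only [Fr_x, q4_zero]
  · simp only [Fr_y, q4_zero, neg_zero]
  · simp only [Fr_y, Fr_x, q4_neg, neg_zero]

end

/-- induced map from a free module -/
def ind (A M : GSupMod k (Fin 2)) (u : A.carrier →ₗ[k] M.carrier) :
    (Fr A).carrier →ₗ[k] M.carrier :=
  let F : (A.carrier × A.carrier × A.carrier × A.carrier) →ₗ[k] M.carrier :=
   { toFun := fun q =>
      u q.1 + M.θ 0 (u q.2.1) + M.θ 1 (u q.2.2.1) + M.θ 0 (M.θ 1 (u q.2.2.2))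
     map_add' := fun a b => by simp; abel
     map_smul' := fun a b => by simp }
  F

theorem ind_apply (A M : GSupMod k (Fin 2)) (u : A.carrier →ₗ[k] M.carrier) (a b c d) :
    ind A M u (q4 A a b c d) = u a + M.θ 0 (u b) + M.θ 1 (u c) + M.θ 0 (M.θ 1 (u d)) := rfl

theorem ind_hom (A M : GSupMod k (Fin 2)) (hM : Rel M) (u : A.carrier →ₗ[k] M.carrier)
    (hu : ∀ a, u (pr A a) = pr M (u a)) : IsHom (Fr A) M (ind A M u) := by
  rw [isHom_iff]
  constructor
  · intro i q
    obtain ⟨a, b, c, d, rfl⟩ := q4_cases A q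
    fin_cases i
    · change ind A M u ((Fr A).θ 0 _) = M.θ 0 _
      rw [Fr_x, ind_apply, ind_apply]
      simp [hM.xx]
    · change ind A M u ((Fr A).θ 1 _) = M.θ 1 _
      rw [Fr_y, ind_apply, ind_apply]
      simp [hM.yy, hM.yx]
  · intro q
    obtain ⟨a, b, c, d, rfl⟩ := q4_cases A q
    rw [Fr_p, ind_apply, ind_apply]
    simp only [map_sub, map_add, hu, θ_pr]
    abel

theorem hom_Fr (A M : GSupMod k (Fin 2)) (f : (Fr A).carrier →ₗ[k] M.carrier)
    (hf : IsHom (Fr A) M f) (a b c d : A.carrier) :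
    f (q4 A a b c d) = f (itp A a) + M.θ 0 (f (itp A b)) + M.θ 1 (f (itp A c))
      + M.θ 0 (M.θ 1 (f (itp A d))) := by
  rw [isHom_iff] at hf
  simp only [← hf.1, ← map_add, itp_apply, Fr_x, Fr_y, q4_add]
  simp

/-- coinduced map to a free module -/
def coind (A M : GSupMod k (Fin 2)) (g : M.carrier →ₗ[k] A.carrier) :
    M.carrier →ₗ[k] (Fr A).carrier where
  toFun m := q4 A (g (M.θ 0 (M.θ 1 m))) (- g (M.θ 1 m)) (g (M.θ 0 m)) (g m)
  map_add' a b := by simp [q4_add]; congr 1; abel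
  map_smul' a b := by simp [q4_smul]

theorem coind_apply (A M : GSupMod k (Fin 2)) (g : M.carrier →ₗ[k] A.carrier) (m) :
    coind A M g m = q4 A (g (M.θ 0 (M.θ 1 m))) (- g (M.θ 1 m)) (g (M.θ 0 m)) (g m) := rfl

theorem coind_hom (A M : GSupMod k (Fin 2)) (hM : Rel M) (g : M.carrier →ₗ[k] A.carrier)
    (hg : ∀ a, g (pr M a) = pr A (g a)) : IsHom M (Fr A) (coind A M g) := by
  rw [isHom_iff]
  constructor
  · intro i m
    fin_cases i
    · change coind A M g (M.θ 0 m) = (Fr A).θ 0 _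
      rw [coind_apply, coind_apply, Fr_x]
      simp [hM.xx, hM.yx]
    · change coind A M g (M.θ 1 m) = (Fr A).θ 1 _
      rw [coind_apply, coind_apply, Fr_y]
      simp [hM.yy]
  · intro m
    rw [coind_apply, coind_apply, Fr_p, q4_inj]
    simp only [map_sub, map_neg, θ_pr, hg]
    refine ⟨?_, ?_, ?_, ?_⟩
    all_goals first | trivial | rfl | abel

theorem hom_to_Fr (A M : GSupMod k (Fin 2)) (f : M.carrier →ₗ[k] (Fr A).carrier)
    (hf : IsHom M (Fr A) f) (m : M.carrier) :
    f m = q4 A (so A (f (M.θ 0 (M.θ 1 m)))) (- so A (f (M.θ 1 m))) (so A (f (M.θ 0 m)))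
      (so A (f m)) := by
  rw [isHom_iff] at hf
  simp only [hf.1]
  obtain ⟨a, b, c, d, h⟩ := q4_cases A (f m)
  simp only [h, Fr_x, Fr_y, so_q4, neg_neg]

theorem Fr_projective [CharZero k] (A : GSupMod k (Fin 2)) : IsProjective (VCat k 2) (Fr A) := by
  refine ⟨(vcat_iff _).2 (rel_Fr A), ?_⟩
  intro M N π f hM hN hπ hs hf
  rw [vcat_iff] at hM hN
  obtain ⟨s, hs'⟩ := π.exists_rightInverse_of_surjective (LinearMap.range_eq_top.2 hs)
  have hs2 : ∀ n, π (s n) = n := fun n => by simpa using LinearMap.congr_fun hs' n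
  let t : A.carrier →ₗ[k] M.carrier := s ∘ₗ f ∘ₗ itp A
  have ht : ∀ a, π (t a) = f (itp A a) := fun a => by simp [t, hs2]
  have hπ' := (isHom_iff _ _ _).1 hπ
  have hf' := (isHom_iff _ _ _).1 hf
  have hιp : ∀ a, itp A (pr A a) = pr (Fr A) (itp A a) := by
    intro a
    rw [itp_apply, itp_apply, Fr_p]; simp
  have hu : ∀ a, π (avg A M t a) = f (itp A a) := by
    intro a
    rw [avg_apply]
    simp only [map_add, map_sub, hπ'.2, ht, hιp, hf'.2, pr_pr]
    abel
  refine ⟨ind A M (avg A M t), ind_hom A M hM _ (avg_pr A M t), ?_⟩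
  apply LinearMap.ext
  intro q
  obtain ⟨a, b, c, d, rfl⟩ := q4_cases A q
  rw [LinearMap.comp_apply, ind_apply, hom_Fr A N f hf]
  simp only [map_add, hπ'.1, hu]

theorem Fr_injective [CharZero k] (A : GSupMod k (Fin 2)) : IsInjective (VCat k 2) (Fr A) := by
  refine ⟨(vcat_iff _).2 (rel_Fr A), ?_⟩
  intro M N j f hM hN hj hi hf
  rw [vcat_iff] at hM hN
  obtain ⟨r, hr⟩ := j.exists_leftInverse_of_injective (LinearMap.ker_eq_bot.2 hi)
  have hr2 : ∀ n, r (j n) = n := fun n => by simpa using LinearMap.congr_fun hr n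
  let t : N.carrier →ₗ[k] A.carrier := so A ∘ₗ f ∘ₗ r
  have ht : ∀ m, t (j m) = so A (f m) := fun m => by simp [t, hr2]
  have hj' := (isHom_iff _ _ _).1 hj
  have hf' := (isHom_iff _ _ _).1 hf
  have hlp : ∀ q, so A (pr (Fr A) q) = pr A (so A q) := by
    intro q
    obtain ⟨a, b, c, d, rfl⟩ := q4_cases A q
    rw [Fr_p, so_q4, so_q4]
  have hu : ∀ m, avg N A t (j m) = so A (f m) := by
    intro m
    rw [avg_apply, ← hj'.2, ← map_sub, ht, ht]
    simp only [map_sub, hf'.2, hlp, pr_pr]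
    abel
  refine ⟨coind A N (avg N A t), coind_hom A N hN _ (avg_pr N A t), ?_⟩
  apply LinearMap.ext
  intro m
  rw [LinearMap.comp_apply, coind_apply, hom_to_Fr A M f hf]
  simp only [← hj'.1, hu]

/-! subobjects and quotients -/

/-- graded subspaces, with zero action -/
theorem exists_grsub (M : GSupMod k (Fin 2)) (U : Submodule k M.carrier)
    (hU : ∀ m ∈ U, pr M m ∈ U) :
    ∃ (A : GSupMod k (Fin 2)) (i : A.carrier →ₗ[k] M.carrier), Function.Injective i ∧
      LinearMap.range i = U ∧ ∀ a, i (pr A a) = pr M (i a) := by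
  refine ⟨mkG U ((pr M).restrict hU) (fun m => Subtype.ext (by simp [pr_pr])) 0
    (by simp), U.subtype, U.subtype_injective, by simp, fun a => ?_⟩
  rw [pr_mkG]; rfl

/-- invariant graded subspaces -/
theorem exists_sub (M : GSupMod k (Fin 2)) (U : Submodule k M.carrier)
    (hU : ∀ m ∈ U, pr M m ∈ U) (hθ : ∀ i, ∀ m ∈ U, M.θ i m ∈ U) :
    ∃ (A : GSupMod k (Fin 2)) (i : A.carrier →ₗ[k] M.carrier), Function.Injective i ∧
      LinearMap.range i = U ∧ IsHom A M i := by
  refine ⟨mkG U ((pr M).restrict hU) (fun m => Subtype.ext (by simp [pr_pr]))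
    (fun i => (M.θ i).restrict (hθ i))
    (fun i m => Subtype.ext (by simp [θ_pr])), U.subtype, U.subtype_injective, by simp, ?_⟩
  rw [isHom_iff]
  refine ⟨fun i m => rfl, fun a => ?_⟩
  rw [pr_mkG]; rfl

/-- quotients -/
theorem exists_quot (M : GSupMod k (Fin 2)) (U : Submodule k M.carrier)
    (hU : ∀ m ∈ U, pr M m ∈ U) (hθ : ∀ i, ∀ m ∈ U, M.θ i m ∈ U) :
    ∃ (A : GSupMod k (Fin 2)) (p : M.carrier →ₗ[k] A.carrier), Function.Surjective p ∧
      LinearMap.ker p = U ∧ IsHom M A p := by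
  refine ⟨mkG (M.carrier ⧸ U) (U.mapQ U (pr M) hU)
    (fun m => ?_) (fun i => U.mapQ U (M.θ i) (hθ i)) (fun i m => ?_),
    U.mkQ, U.mkQ_surjective, by simp, ?_⟩
  · obtain ⟨m, rfl⟩ := U.mkQ_surjective m
    simp [pr_pr]
  · obtain ⟨m, rfl⟩ := U.mkQ_surjective m
    simp [θ_pr]
  rw [isHom_iff]
  refine ⟨fun i m => rfl, fun a => ?_⟩
  rw [pr_mkG]; rfl

/-- graded retraction onto a graded subspace -/
theorem exists_retr (A M : GSupMod k (Fin 2)) (i : A.carrier →ₗ[k] M.carrier)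
    (hi : Function.Injective i) (hp : ∀ a, i (pr A a) = pr M (i a)) :
    ∃ g : M.carrier →ₗ[k] A.carrier, (∀ a, g (i a) = a) ∧ ∀ m, g (pr M m) = pr A (g m) := by
  obtain ⟨r, hr⟩ := i.exists_leftInverse_of_injective (LinearMap.ker_eq_bot.2 hi)
  have hr2 : ∀ n, r (i n) = n := fun n => by simpa using LinearMap.congr_fun hr n
  refine ⟨avg M A r, fun a => ?_, avg_pr _ _ _⟩
  rw [avg_apply, ← hp, ← map_sub, hr2, hr2]
  simp [pr_pr]

end Aux

end SupCat

namespace SupCat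

open Submodule GSupMod

namespace Aux

variable {k : Type} [Field k]

/-- the action of a general odd element -/
def act (M : GSupMod k (Fin 2)) (a b : k) : M.carrier →ₗ[k] M.carrier := a • M.θ 0 + b • M.θ 1

theorem act_apply (M : GSupMod k (Fin 2)) (a b : k) (m) :
    act M a b m = a • M.θ 0 m + b • M.θ 1 m := rfl

theorem act_hom {M N : GSupMod k (Fin 2)} {f : M.carrier →ₗ[k] N.carrier} (hf : IsHom M N f)
    (a b : k) (m) : f (act M a b m) = act N a b (f m) := by
  rw [isHom_iff] at hf
  simp [act_apply, hf.1]

theorem act_act {M : GSupMod k (Fin 2)} (h : Rel M) (a b : k) (m) :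
    act M a b (act M a b m) = 0 := by
  simp only [act_apply, map_add, map_smul, h.xx, h.yy, h.yx, smul_add, smul_neg, smul_zero,
    smul_comm b a]
  simp

theorem Fr_act (A : GSupMod k (Fin 2)) (r s : k) (a b c d) :
    act (Fr A) r s (q4 A a b c d) = q4 A 0 (r • a) (s • a) (r • c - s • b) := by
  simp [act_apply, Fr_x, Fr_y, q4_smul, q4_add, sub_eq_add_neg]

/-- exactness for a free module -/
theorem Fr_exact (A : GSupMod k (Fin 2)) (r s : k) (h : r ≠ 0 ∨ s ≠ 0) (q)
    (hq : act (Fr A) r s q = 0) : ∃ q', act (Fr A) r s q' = q := by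
  obtain ⟨a, b, c, d, rfl⟩ := q4_cases A q
  rw [Fr_act, q4_zero, q4_inj] at hq
  obtain ⟨-, h1, h2, h3⟩ := hq
  have ha : a = 0 := by
    rcases h with h | h
    · exact (smul_eq_zero.1 h1).resolve_left h
    · exact (smul_eq_zero.1 h2).resolve_left h
  subst ha
  by_cases hr : r = 0
  · subst hr
    have hs : s ≠ 0 := by simpa using h
    have hb : b = 0 := by
      simp only [zero_smul, zero_sub, neg_eq_zero] at h3
      exact (smul_eq_zero.1 h3).resolve_left hs
    subst hb
    refine ⟨q4 A (s⁻¹ • c) (-(s⁻¹ • d)) 0 0, ?_⟩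
    rw [Fr_act, q4_inj]
    simp [smul_smul, hs]
  · refine ⟨q4 A (r⁻¹ • b) 0 (r⁻¹ • d) 0, ?_⟩
    rw [Fr_act, q4_inj]
    refine ⟨rfl, by simp [smul_smul, hr], ?_, by simp [smul_smul, hr]⟩
    rw [smul_comm, ← sub_eq_zero.1 h3, smul_smul, inv_mul_cancel₀ hr, one_smul]

theorem proj_exact [CharZero k] (P : GSupMod k (Fin 2)) (hP : IsProjective (VCat k 2) P)
    (r s : k) (h : r ≠ 0 ∨ s ≠ 0) (q)
    (hq : act P r s q = 0) : ∃ q', act P r s q' = q := by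
  have hR := (vcat_iff _).1 hP.1
  have hi := ind_hom P P hR LinearMap.id (fun a => rfl)
  obtain ⟨t, ht, ht2⟩ := hP.2 (Fr P) P (ind P P LinearMap.id) LinearMap.id
    ((vcat_iff _).2 (rel_Fr P)) hP.1 hi
    (fun m => ⟨q4 P m 0 0 0, by rw [ind_apply]; simp⟩) ((isHom_iff _ _ _).2 ⟨fun _ _ => rfl, fun _ => rfl⟩)
  obtain ⟨q', hq'⟩ := Fr_exact P r s h (t q) (by rw [← act_hom ht, hq, map_zero])
  refine ⟨ind P P LinearMap.id q', ?_⟩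
  rw [← act_hom hi, hq']
  simpa using LinearMap.congr_fun ht2 q

/-- direct sums -/
theorem dsum_act {A B S : GSupMod k (Fin 2)} {φ : S.carrier ≃ₗ[k] A.carrier × B.carrier}
    (hφ : ∀ (i : Fin 2) (s : S.carrier),
      φ (S.θ i s) = LinearMap.prodMap (A.θ i) (B.θ i) (φ s)) (r s : k) (m) :
    φ (act S r s m) = (act A r s (φ m).1, act B r s (φ m).2) := by
  simp [act_apply, hφ]

theorem finrank_prodS {V W : Type} [AddCommGroup V] [Module k V] [AddCommGroup W] [Module k W]
    [FiniteDimensional k V] [FiniteDimensional k W]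
    (U : Submodule k V) (U' : Submodule k W) :
    Module.finrank k (U.prod U') = Module.finrank k U + Module.finrank k U' := by
  rw [← Module.finrank_prod, ← LinearMap.finrank_range_of_inj
    (f := LinearMap.prodMap U.subtype U'.subtype)
    (Function.Injective.prodMap U.subtype_injective U'.subtype_injective)]
  rw [LinearMap.range_prodMap, Submodule.range_subtype, Submodule.range_subtype]

theorem finrank_range_conj {V W : Type} [AddCommGroup V] [Module k V] [AddCommGroup W] [Module k W]
    [FiniteDimensional k V] [FiniteDimensional k W] (e : V ≃ₗ[k] W) (f : V →ₗ[k] V)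
    (g : W →ₗ[k] W) (h : ∀ m, e (f m) = g (e m)) :
    Module.finrank k (LinearMap.range f) = Module.finrank k (LinearMap.range g) := by
  have : LinearMap.range g = (LinearMap.range f).map (e : V →ₗ[k] W) := by
    ext w
    simp only [LinearMap.mem_range, Submodule.mem_map]
    constructor
    · rintro ⟨w, rfl⟩
      exact ⟨f (e.symm w), ⟨_, rfl⟩, by simp [h]⟩
    · rintro ⟨_, ⟨v, rfl⟩, rfl⟩
      exact ⟨e v, (h v).symm⟩
  rw [this]
  exact (LinearEquiv.finrank_map_eq e _).symm

theorem dsum_rank {A B S : GSupMod k (Fin 2)} (h : IsDsum A B S) (r s : k) :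
    Module.finrank k (LinearMap.range (act S r s)) =
    Module.finrank k (LinearMap.range (act A r s)) +
    Module.finrank k (LinearMap.range (act B r s)) := by
  obtain ⟨φ, -, -, hφ⟩ := h
  rw [finrank_range_conj φ (act S r s) (LinearMap.prodMap (act A r s) (act B r s))
    (fun m => by rw [dsum_act hφ]; rfl), LinearMap.range_prodMap, finrank_prodS]

theorem dsum_finrank {A B S : GSupMod k (Fin 2)} (h : IsDsum A B S) :
    Module.finrank k S.carrier = Module.finrank k A.carrier + Module.finrank k B.carrier := by
  obtain ⟨φ, -⟩ := h
  rw [φ.finrank_eq, Module.finrank_prod]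

theorem exact_rank {P : GSupMod k (Fin 2)} (hR : Rel P) (r s : k)
    (h : ∀ q, act P r s q = 0 → ∃ q', act P r s q' = q) :
    Module.finrank k P.carrier = 2 * Module.finrank k (LinearMap.range (act P r s)) := by
  have : LinearMap.ker (act P r s) = LinearMap.range (act P r s) := by
    ext q
    simp only [LinearMap.mem_ker, LinearMap.mem_range]
    exact ⟨h q, by rintro ⟨q', rfl⟩; exact act_act hR r s q'⟩
  have h2 := (act P r s).finrank_range_add_finrank_ker
  rw [this] at h2
  omega

/-- first step: homology of an endotrivial module is one-dimensional -/
theorem endo_rank [CharZero k] (M : GSupMod k (Fin 2))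
    (hE : IsEndotrivial (VCat k 2) M) (r s : k) (hrs : r ≠ 0 ∨ s ≠ 0) :
    Module.finrank k M.carrier = 2 * Module.finrank k (LinearMap.range (act M r s)) + 1 := by
  obtain ⟨hM, H, K, P, S, ⟨φ, -, -, hφ⟩, -, ⟨hK1, hK2, -⟩, hP, hS, ⟨e, he⟩⟩ := hE
  rw [vcat_iff] at hM
  -- parity
  have hPr := exact_rank ((vcat_iff _).1 hP.1) r s (proj_exact P hP r s hrs)
  have d1 : Module.finrank k M.carrier * Module.finrank k M.carrier
      = 1 + Module.finrank k P.carrier := by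
    rw [← hK1, ← dsum_finrank hS, ← e.finrank_eq, φ.finrank_eq, Module.finrank_linearMap]
  have hodd : ¬ (2 ∣ Module.finrank k M.carrier) := by
    intro h
    have := Dvd.dvd.mul_right h (Module.finrank k M.carrier)
    omega
  set V := act M r s with hV
  have hle : LinearMap.range V ≤ LinearMap.ker V := by
    rintro _ ⟨m, rfl⟩
    exact act_act hM r s m
  have hrn := V.finrank_range_add_finrank_ker
  have hle' := Submodule.finrank_mono hle
  -- the differential
  have hsig : ∀ m, M.sigma (V m) = - V (M.sigma m) := by
    intro m
    simp only [hV, act_apply, sigma_apply, map_add, map_sub, map_smul, pr_θ, smul_sub]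
    abel
  have hD : ∀ h, φ (act H r s h) = V ∘ₗ φ h - (M.sigma ∘ₗ φ h ∘ₗ M.sigma) ∘ₗ V := by
    intro h
    ext m
    simp [act_apply, hφ, hV, smul_sub]
    abel
  -- two closed elements are dependent modulo boundaries
  have key : ∀ f1 f2 : H.carrier, act H r s f1 = 0 → act H r s f2 = 0 →
      ∃ α β : k, (α ≠ 0 ∨ β ≠ 0) ∧ ∃ g, act H r s g = α • f1 + β • f2 := by
    intro f1 f2 h1 h2
    obtain ⟨ψ, -, -, hψ⟩ := hS
    have ha := fun m => dsum_act hψ r s m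
    have hdep : ∃ α β : k, (α ≠ 0 ∨ β ≠ 0) ∧ α • (ψ (e f1)).1 + β • (ψ (e f2)).1 = 0 := by
      by_cases h0 : (ψ (e f1)).1 = 0
      · exact ⟨1, 0, by simp, by simp [h0]⟩
      · obtain ⟨c, hc⟩ := exists_smul_eq_of_finrank_eq_one hK1 h0 (ψ (e f2)).1
        exact ⟨c, -1, by simp, by simp [hc]⟩
    obtain ⟨α, β, hαβ, h0⟩ := hdep
    refine ⟨α, β, hαβ, ?_⟩
    have hz : act P r s (ψ (e (α • f1 + β • f2))).2 = 0 := by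
      have := ha (e (α • f1 + β • f2))
      have h3 : act S r s (e (α • f1 + β • f2)) = 0 := by
        have := act_hom he r s (α • f1 + β • f2)
        simp only [LinearEquiv.coe_coe] at this
        rw [← this]
        simp [h1, h2]
      rw [h3, map_zero] at this
      exact (Prod.ext_iff.1 this).2.symm
    obtain ⟨q, hq⟩ := proj_exact P hP r s hrs _ hz
    refine ⟨e.symm (ψ.symm (0, q)), ?_⟩
    apply e.injective
    apply ψ.injective
    have h4 := act_hom he r s (e.symm (ψ.symm (0, q)))
    simp only [LinearEquiv.coe_coe] at h4
    rw [h4, ha]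
    simp only [LinearEquiv.apply_symm_apply, hq]
    ext
    · simp [h0]
    · rfl
  -- now show at most one-dimensional
  suffices hh : Module.finrank k (LinearMap.ker V) ≤ Module.finrank k (LinearMap.range V) + 1 by
    omega
  by_cases hlt : LinearMap.ker V ≤ LinearMap.range V
  · have := Submodule.finrank_mono hlt
    omega
  obtain ⟨c1, hc1, hc1'⟩ := Set.not_subset.1 hlt
  change V c1 = 0 at hc1
  obtain ⟨ξ, hξ1, hξ2⟩ := Submodule.exists_dual_map_eq_bot_of_notMem hc1' inferInstance
  have hξ : ∀ m, ξ (V m) = 0 := by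
    intro m
    have : ξ (V m) ∈ (LinearMap.range V).map ξ := Submodule.mem_map_of_mem ⟨m, rfl⟩
    rw [hξ2] at this
    simpa using this
  have hle2 : LinearMap.ker V ≤ LinearMap.range V ⊔ Submodule.span k {c1} := by
    intro c2 hc2
    have hc2' : V c2 = 0 := hc2
    have closed : ∀ c, V c = 0 → act H r s (φ.symm (ξ.smulRight c)) = 0 := by
      intro c hc
      apply φ.injective
      rw [hD, map_zero]
      ext m
      have : M.sigma (V m) = - V (M.sigma m) := hsig m
      simp [hc, this, hξ]
    obtain ⟨α, β, hαβ, g, hg⟩ := key _ _ (closed c1 hc1) (closed c2 hc2')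
    have h5 := congrArg φ hg
    rw [hD] at h5
    have h6 := LinearMap.congr_fun h5 c1
    simp [hc1] at h6
    have h7 : α • c1 + β • c2 = V ((ξ c1)⁻¹ • φ g c1) := by
      rw [map_smul, h6, smul_add, smul_smul, smul_smul, smul_smul, smul_smul]
      congr 2 <;> field_simp
    have hβ : β ≠ 0 := by
      rintro rfl
      have hα : α ≠ 0 := by simpa using hαβ
      apply hc1'
      refine ⟨α⁻¹ • ((ξ c1)⁻¹ • φ g c1), ?_⟩
      rw [map_smul, ← h7]
      simp [smul_smul, hα]
    refine Submodule.mem_sup.2 ⟨V (β⁻¹ • ((ξ c1)⁻¹ • φ g c1)), ⟨_, rfl⟩, -(β⁻¹ * α) • c1,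
      Submodule.smul_mem _ _ (Submodule.mem_span_singleton_self _), ?_⟩
    rw [map_smul, ← h7]
    simp [smul_smul, hβ]
  calc _ ≤ _ := Submodule.finrank_mono hle2
    _ ≤ _ := Submodule.finrank_add_le_finrank_add_finrank _ _
    _ ≤ _ := by
      gcongr
      exact (finrank_span_le_card _).trans (by simp)

end Aux

end SupCat

namespace SupCat

open Submodule GSupMod

namespace Aux

variable {k : Type} [Field k]

theorem rel_of_surj {M N : GSupMod k (Fin 2)} {f : M.carrier →ₗ[k] N.carrier} (hf : IsHom M N f)
    (hs : Function.Surjective f) (h : Rel M) : Rel N := by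
  have h' := ((isHom_iff _ _ _).1 hf).1
  constructor <;> intro n <;> obtain ⟨m, rfl⟩ := hs n <;> simp only [← h']
  · rw [h.xx, map_zero]
  · rw [h.yy, map_zero]
  · rw [h.yx, map_neg]

theorem rel_of_inj {M N : GSupMod k (Fin 2)} {f : M.carrier →ₗ[k] N.carrier} (hf : IsHom M N f)
    (hs : Function.Injective f) (h : Rel N) : Rel M := by
  have h' := ((isHom_iff _ _ _).1 hf).1
  constructor <;> intro n <;> apply hs <;> simp only [h', map_neg, map_zero]
  · rw [h.xx]
  · rw [h.yy]
  · rw [h.yx]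

/-- Nakayama for free modules -/
theorem surj_of_top {Q A : GSupMod k (Fin 2)} {f : Q.carrier →ₗ[k] (Fr A).carrier}
    (hf : IsHom Q (Fr A) f) (h : ∀ w, ∃ m, tp A (f m) = w) : Function.Surjective f := by
  have h' := ((isHom_iff _ _ _).1 hf).1
  have e4 : ∀ w, q4 A 0 0 0 w ∈ LinearMap.range f := by
    intro w
    obtain ⟨m, hm⟩ := h w
    refine ⟨Q.θ 0 (Q.θ 1 m), ?_⟩
    obtain ⟨a, b, c, d, hq⟩ := q4_cases A (f m)
    rw [hq, tp_q4] at hm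
    rw [h', h', hq, Fr_y, Fr_x, hm]
  have e2 : ∀ w, q4 A 0 w 0 0 ∈ LinearMap.range f := by
    intro w
    obtain ⟨m, hm⟩ := h w
    obtain ⟨a, b, c, d, hq⟩ := q4_cases A (f m)
    rw [hq, tp_q4] at hm
    have : q4 A 0 w 0 0 = f (Q.θ 0 m) - q4 A 0 0 0 c := by
      rw [h', hq, Fr_x, hm, q4_sub]; simp
    rw [this]
    exact sub_mem ⟨_, rfl⟩ (e4 c)
  have e3 : ∀ w, q4 A 0 0 w 0 ∈ LinearMap.range f := by
    intro w
    obtain ⟨m, hm⟩ := h w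
    obtain ⟨a, b, c, d, hq⟩ := q4_cases A (f m)
    rw [hq, tp_q4] at hm
    have : q4 A 0 0 w 0 = f (Q.θ 1 m) - q4 A 0 0 0 (-b) := by
      rw [h', hq, Fr_y, hm, q4_sub]; simp
    rw [this]
    exact sub_mem ⟨_, rfl⟩ (e4 _)
  intro q
  obtain ⟨a, b, c, d, rfl⟩ := q4_cases A q
  obtain ⟨m, hm⟩ := h a
  obtain ⟨a', b', c', d', hq⟩ := q4_cases A (f m)
  rw [hq, tp_q4] at hm
  have : q4 A a b c d = f m + q4 A 0 (b - b') 0 0 + q4 A 0 0 (c - c') 0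
      + q4 A 0 0 0 (d - d') := by
    rw [hq, hm]; simp [q4_add]
  change q4 A a b c d ∈ LinearMap.range f
  rw [this]
  exact add_mem (add_mem (add_mem ⟨_, rfl⟩ (e2 _)) (e3 _)) (e4 _)

theorem dsum_of {A B S : GSupMod k (Fin 2)} (i : A.carrier →ₗ[k] S.carrier)
    (s : B.carrier →ₗ[k] S.carrier) (hi : IsHom A S i) (hs : IsHom B S s)
    (h : Function.Bijective (LinearMap.coprod i s)) : IsDsum A B S := by
  let e := LinearEquiv.ofBijective _ h
  have he : ∀ q, e q = i q.1 + s q.2 := fun q => rfl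
  have hi' := (isHom_iff _ _ _).1 hi
  have hs' := (isHom_iff _ _ _).1 hs
  refine ⟨e.symm, fun m => ?_, fun m => ?_, fun j m => ?_⟩
  · obtain ⟨q, rfl⟩ := e.surjective m
    rw [mem_ev, mem_ev, mem_ev, LinearEquiv.symm_apply_apply]
    have : pr S (e q) = e (pr A q.1, pr B q.2) := by
      simp [he, hi'.2, hs'.2]
    rw [this, e.injective.eq_iff, Prod.ext_iff]
  · obtain ⟨q, rfl⟩ := e.surjective m
    rw [mem_od, mem_od, mem_od, LinearEquiv.symm_apply_apply]
    have : pr S (e q) = e (pr A q.1, pr B q.2) := by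
      simp [he, hi'.2, hs'.2]
    rw [this, LinearEquiv.map_eq_zero_iff, Prod.ext_iff]
    rfl
  · obtain ⟨q, rfl⟩ := e.surjective m
    apply e.injective
    rw [LinearEquiv.apply_symm_apply, LinearEquiv.symm_apply_apply, he, he]
    simp [hi'.1, hs'.1]

/-- splitting off a free summand -/
theorem strip [CharZero k] (M : GSupMod k (Fin 2)) (hM : Rel M) :
    ∃ N W : GSupMod k (Fin 2), IsDsum N (Fr W) M ∧ Rel N ∧ ∀ m, N.θ 0 (N.θ 1 m) = 0 := by
  obtain ⟨W, i, hi, hr, hp⟩ := exists_grsub M (LinearMap.range (M.θ 0 ∘ₗ M.θ 1)) (by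
    rintro _ ⟨m, rfl⟩
    refine ⟨pr M m, ?_⟩
    simp [θ_pr])
  obtain ⟨g, hg, hgp⟩ := exists_retr W M i hi hp
  have hρ := coind_hom W M hM g hgp
  set ρ := coind W M g with hρd
  have hρ' := (isHom_iff _ _ _).1 hρ
  have hs : Function.Surjective ρ := by
    apply surj_of_top hρ
    intro w
    have : i w ∈ LinearMap.range i := ⟨w, rfl⟩
    rw [hr] at this
    obtain ⟨m, hm⟩ := this
    refine ⟨m, ?_⟩
    rw [LinearMap.comp_apply] at hm
    rw [hρd, coind_apply, tp_q4, hm, hg]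
  obtain ⟨s, hsh, hss⟩ := (Fr_projective W).2 M (Fr W) ρ LinearMap.id ((vcat_iff _).2 hM)
    ((vcat_iff _).2 (rel_Fr W)) hρ hs ((isHom_iff _ _ _).2 ⟨fun _ _ => rfl, fun _ => rfl⟩)
  have hss' : ∀ q, ρ (s q) = q := fun q => by simpa using LinearMap.congr_fun hss q
  obtain ⟨N, ι, hι, hιr, hιh⟩ := exists_sub M (LinearMap.ker ρ)
    (by intro m hm; rw [LinearMap.mem_ker] at *; rw [hρ'.2, hm, map_zero])
    (by intro i m hm; rw [LinearMap.mem_ker] at *; rw [hρ'.1, hm, map_zero])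
  have hker : ∀ n, ρ (ι n) = 0 := fun n => by
    have : ι n ∈ LinearMap.range ι := ⟨n, rfl⟩
    rwa [hιr] at this
  refine ⟨N, W, dsum_of ι s hιh hsh ⟨?_, ?_⟩, rel_of_inj hιh hι hM, ?_⟩
  · rw [injective_iff_map_eq_zero]
    rintro ⟨n, q⟩ h
    simp only [LinearMap.coprod_apply] at h
    have h2 := congrArg ρ h
    simp only [map_add, hker, hss', zero_add, map_zero] at h2
    subst h2
    rw [map_zero, add_zero] at h
    rw [(map_eq_zero_iff ι hι).1 h]; rfl
  · intro m
    have : m - s (ρ m) ∈ LinearMap.ker ρ := by simp [hss']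
    rw [← hιr] at this
    obtain ⟨n, hn⟩ := this
    exact ⟨(n, ρ m), by simp [hn]⟩
  · intro n
    apply hι
    have h' := ((isHom_iff _ _ _).1 hιh).1
    rw [h', h', map_zero]
    have h3 := hker n
    rw [hρd, coind_apply, q4_zero, q4_inj] at h3
    have : M.θ 0 (M.θ 1 (ι n)) ∈ LinearMap.range i := by
      rw [hr]; exact ⟨_, rfl⟩
    obtain ⟨w, hw⟩ := this
    rw [← hw, hg] at h3
    rw [← hw, h3.1, map_zero]

structure EE (r : ℕ) (N : GSupMod k (Fin 2)) : Prop where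
  rel : Rel N
  xy : ∀ m, N.θ 0 (N.θ 1 m) = 0
  rk : ∀ a b : k, (a ≠ 0 ∨ b ≠ 0) → Module.finrank k (LinearMap.range (act N a b)) = r
  dim : Module.finrank k N.carrier = 2 * r + 1

theorem EE.zz {r : ℕ} {N : GSupMod k (Fin 2)} (h : EE r N) (i j : Fin 2) (m) :
    N.θ i (N.θ j m) = 0 := by
  fin_cases i <;> fin_cases j
  · exact h.rel.xx m
  · exact h.xy m
  · exact (h.rel.yx m).trans (by rw [h.xy, neg_zero])
  · exact h.rel.yy m

def Pos (r : ℕ) (N : GSupMod k (Fin 2)) : Prop :=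
  EE r N ∧ ∀ a b : k, (a ≠ 0 ∨ b ≠ 0) → ∀ i m, ∃ n, act N a b n = N.θ i m

def Neg (r : ℕ) (N : GSupMod k (Fin 2)) : Prop :=
  EE r N ∧ ∀ a b : k, (a ≠ 0 ∨ b ≠ 0) → ∀ m, act N a b m = 0 → ∀ i, N.θ i m = 0

theorem act_one_zero (N : GSupMod k (Fin 2)) : act N 1 0 = N.θ 0 := by simp [act]

theorem act_zero_one (N : GSupMod k (Fin 2)) : act N 0 1 = N.θ 1 := by simp [act]

theorem EE.ker {r : ℕ} {N : GSupMod k (Fin 2)} (h : EE r N) (a b : k) (hab : a ≠ 0 ∨ b ≠ 0) :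
    Module.finrank k (LinearMap.ker (act N a b)) = r + 1 := by
  have := (act N a b).finrank_range_add_finrank_ker
  rw [h.rk a b hab, h.dim] at this
  omega

theorem dich {r : ℕ} {N : GSupMod k (Fin 2)} (h : EE r N) :
    Pos r N ∨ (Neg r N ∧ ∀ m, N.θ 0 m = 0 → ∃ b c, m = N.θ 0 b + N.θ 1 c) := by
  set U := LinearMap.range (N.θ 0) ⊔ LinearMap.range (N.θ 1) with hU
  have hiU : ∀ i m, N.θ i m ∈ U := by
    intro i m
    fin_cases i
    · exact Submodule.mem_sup_left ⟨m, rfl⟩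
    · exact Submodule.mem_sup_right ⟨m, rfl⟩
  have h0 : ∀ m ∈ U, ∀ i, N.θ i m = 0 := by
    intro m hm i
    obtain ⟨_, ⟨b, rfl⟩, _, ⟨c, rfl⟩, rfl⟩ := Submodule.mem_sup.1 hm
    simp [h.zz]
  have h1 : ∀ a b, LinearMap.range (act N a b) ≤ U := by
    rintro a b _ ⟨m, rfl⟩
    exact add_mem (U.smul_mem _ (hiU 0 m)) (U.smul_mem _ (hiU 1 m))
  have h2 : ∀ a b, U ≤ LinearMap.ker (act N a b) := by
    intro a b m hm
    simp [act_apply, h0 m hm]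
  have h3 := Submodule.finrank_mono (h1 1 0)
  have h4 := Submodule.finrank_mono (h2 1 0)
  rw [h.rk 1 0 (by simp)] at h3
  rw [h.ker 1 0 (by simp)] at h4
  by_cases hr : Module.finrank k U = r
  · left
    refine ⟨h, fun a b hab i m => ?_⟩
    have := Submodule.eq_of_le_of_finrank_le (h1 a b) (by rw [hr, h.rk a b hab])
    have h5 := hiU i m
    rwa [← this] at h5
  · right
    have key : ∀ a b : k, (a ≠ 0 ∨ b ≠ 0) → U = LinearMap.ker (act N a b) := fun a b hab =>
      Submodule.eq_of_le_of_finrank_le (h2 a b) (by rw [h.ker a b hab]; omega)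
    refine ⟨⟨h, fun a b hab m hm => h0 m ?_⟩, fun m hm => ?_⟩
    · rw [key a b hab]; exact hm
    · have : m ∈ U := by
        rw [key 1 0 (by simp), act_one_zero]; exact hm
      obtain ⟨_, ⟨b, rfl⟩, _, ⟨c, rfl⟩, rfl⟩ := Submodule.mem_sup.1 this
      exact ⟨b, c, rfl⟩

theorem posSoc [IsAlgClosed k] {r : ℕ} {N : GSupMod k (Fin 2)} (h : Pos (r + 1) N) (m)
    (h0 : N.θ 0 m = 0) (h1 : N.θ 1 m = 0) : ∃ n, N.θ 0 n = m := by
  obtain ⟨hE, hr⟩ := h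
  set R := LinearMap.range (N.θ 0) with hR
  have hfr : Module.finrank k R = r + 1 := by
    have := hE.rk 1 0 (by simp)
    rwa [act_one_zero] at this
  have hyR : ∀ m, N.θ 1 m ∈ R := by
    intro m
    have := hr 1 0 (by simp) 1 m
    rwa [act_one_zero] at this
  obtain ⟨s, hs⟩ := (N.θ 0).rangeRestrict.exists_rightInverse_of_surjective
    (LinearMap.range_rangeRestrict _)
  have hs' : ∀ w : R, N.θ 0 (s w) = w := fun w => by
    have := LinearMap.congr_fun hs w
    exact congrArg Subtype.val this
  have : Nontrivial R := Module.nontrivial_of_finrank_pos (R := k) (by omega)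
  let T : Module.End k R := ((N.θ 1).codRestrict R hyR) ∘ₗ s
  obtain ⟨μ, hμ⟩ := Module.End.exists_eigenvalue T
  obtain ⟨w, hw⟩ := hμ.exists_hasEigenvector
  have hw1 : N.θ 1 (s w) = μ • (w : N.carrier) := congrArg Subtype.val hw.apply_eq_smul
  have hw2 : (w : N.carrier) ≠ 0 := fun h => hw.2 (Subtype.ext h)
  have hk : act N (-μ) 1 (s w) = 0 := by
    simp [act_apply, hs', hw1]
  set S := LinearMap.ker (N.θ 0) ⊓ LinearMap.ker (N.θ 1) with hS
  have hlt : S < LinearMap.ker (act N (-μ) 1) := by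
    refine lt_of_le_of_ne ?_ ?_
    · rintro m ⟨h1, h2⟩
      simp only [LinearMap.mem_ker, SetLike.mem_coe] at h1 h2
      simp [act_apply, h1, h2]
    · intro he
      have : s w ∈ S := by rw [he]; exact hk
      apply hw2
      rw [← hs']
      exact this.1
  have hlt' := Submodule.finrank_lt_finrank_of_lt hlt
  rw [hE.ker _ _ (by simp)] at hlt'
  have hRS : R ≤ S := by
    rintro _ ⟨m, rfl⟩
    exact ⟨hE.zz 0 0 m, hE.zz 1 0 m⟩
  have := Submodule.eq_of_le_of_finrank_le hRS (by omega)
  have hm : m ∈ S := ⟨h0, h1⟩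
  rw [← this] at hm
  exact hm

theorem negRad [IsAlgClosed k] {r : ℕ} {N : GSupMod k (Fin 2)} (h : EE (r + 1) N) (m)
    (h0 : N.θ 0 m = 0) (h1 : N.θ 1 m = 0) : ∃ b c, m = N.θ 0 b + N.θ 1 c := by
  rcases dich h with hp | hn
  · obtain ⟨n, rfl⟩ := posSoc hp m h0 h1
    exact ⟨n, 0, by simp⟩
  · exact hn.2 m h0

end Aux

end SupCat

namespace SupCat

open Submodule GSupMod

namespace Aux

variable {k : Type} [Field k]

theorem posStep [IsAlgClosed k] [CharZero k] {r : ℕ} {N : GSupMod k (Fin 2)}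
    (h : Pos (r + 1) N) : ∃ L, Pos r L ∧ IsSyzygy (VCat k 2) L N := by
  have hsoc := posSoc h
  obtain ⟨hE, hr⟩ := h
  obtain ⟨A, i, hi, hir, hip⟩ := exists_grsub N (LinearMap.range (N.θ 0)) (by
    rintro _ ⟨m, rfl⟩
    exact ⟨m - pr N m, by simp [θ_pr]⟩)
  obtain ⟨g, hg, hgp⟩ := exists_retr A N i hi hip
  have hA : Module.finrank k A.carrier = r + 1 := by
    rw [← LinearMap.finrank_range_of_inj hi, hir, ← act_one_zero, hE.rk 1 0 (by simp)]
  have hmem : ∀ j m, ∃ a, i a = N.θ j m := by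
    intro j m
    have := hr 1 0 (by simp) j m
    rw [act_one_zero] at this
    change N.θ j m ∈ LinearMap.range i
    rw [hir]; exact this
  have hmem0 : ∀ a, ∃ m, N.θ 0 m = i a := by
    intro a
    have : i a ∈ LinearMap.range i := ⟨a, rfl⟩
    rw [hir] at this
    exact this
  have hig : ∀ j m, i (g (N.θ j m)) = N.θ j m := by
    intro j m
    obtain ⟨a, ha⟩ := hmem j m
    rw [← ha, hg]
  have hθi : ∀ j a, N.θ j (i a) = 0 := by
    intro j a
    obtain ⟨m, hm⟩ := hmem0 a
    rw [← hm, hE.zz]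
  have hj := coind_hom A N hE.rel g hgp
  set j := coind A N g with hjd
  have hja : ∀ m, j m = q4 A 0 (- g (N.θ 1 m)) (g (N.θ 0 m)) (g m) := by
    intro m; rw [hjd, coind_apply, hE.xy, map_zero]
  have hji : ∀ a, j (i a) = q4 A 0 0 0 a := by
    intro a; simp [hja, hθi, hg]
  have hinj : Function.Injective j := by
    rw [injective_iff_map_eq_zero]
    intro m hm
    rw [hja, q4_zero, q4_inj] at hm
    obtain ⟨-, h1, h2, h3⟩ := hm
    have e1 : N.θ 1 m = 0 := by rw [← hig, neg_eq_zero.1 h1, map_zero]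
    have e0 : N.θ 0 m = 0 := by rw [← hig, h2, map_zero]
    obtain ⟨n, rfl⟩ := hsoc m e0 e1
    rw [← hig, h3, map_zero]
  have hj' := (isHom_iff _ _ _).1 hj
  obtain ⟨L, p, hps, hpk, hph⟩ := exists_quot (Fr A) (LinearMap.range j)
    (by rintro _ ⟨m, rfl⟩; exact ⟨pr N m, hj'.2 m⟩)
    (by rintro i _ ⟨m, rfl⟩; exact ⟨_, hj'.1 i m⟩)
  have hp' := (isHom_iff _ _ _).1 hph
  have hpj : ∀ m, p (j m) = 0 := fun m => by
    have : j m ∈ LinearMap.range j := ⟨m, rfl⟩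
    rwa [← hpk] at this
  have hptp : ∀ q, p q = 0 → tp A q = 0 := by
    intro q hq
    have : q ∈ LinearMap.ker p := hq
    rw [hpk] at this
    obtain ⟨m, rfl⟩ := this
    rw [hja, tp_q4]
  have hdimL : Module.finrank k L.carrier = 2 * r + 1 := by
    have h1 := p.finrank_range_add_finrank_ker
    rw [hpk, LinearMap.finrank_range_of_inj hinj, LinearMap.range_eq_top.2 hps, finrank_top,
      finrank_Fr, hA, hE.dim] at h1
    omega
  -- the top of L
  obtain ⟨s, hs⟩ := p.exists_rightInverse_of_surjective (LinearMap.range_eq_top.2 hps)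
  have hs' : ∀ l, p (s l) = l := fun l => by simpa using LinearMap.congr_fun hs l
  let t : L.carrier →ₗ[k] A.carrier := tp A ∘ₗ s
  have ht : ∀ q, t (p q) = tp A q := by
    intro q
    have := hptp (s (p q) - q) (by simp [hs'])
    rw [map_sub, sub_eq_zero] at this
    exact this
  have hts : Function.Surjective t := fun a => ⟨p (itp A a), by rw [ht, itp_apply, tp_q4]⟩
  have htk : Module.finrank k (LinearMap.ker t) = r := by
    have h1 := t.finrank_range_add_finrank_ker
    rw [LinearMap.range_eq_top.2 hts, finrank_top, hA, hdimL] at h1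
    omega
  have hrange : ∀ a b : k, (a ≠ 0 ∨ b ≠ 0) → LinearMap.range (act L a b) = LinearMap.ker t := by
    intro α β hab
    apply le_antisymm
    · rintro _ ⟨l, rfl⟩
      obtain ⟨q, rfl⟩ := hps l
      obtain ⟨a, b, c, d, rfl⟩ := q4_cases A q
      rw [LinearMap.mem_ker, ← act_hom hph, ht, Fr_act, tp_q4]
    · intro l hl
      obtain ⟨q, rfl⟩ := hps l
      obtain ⟨a, b, c, d, rfl⟩ := q4_cases A q
      rw [LinearMap.mem_ker, ht, tp_q4] at hl
      subst hl
      obtain ⟨m0, hm0⟩ := hmem0 (α • c - β • b)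
      obtain ⟨m, hm⟩ := hr α β hab 0 m0
      rw [hm0, act_apply] at hm
      have hm1 := congrArg g hm
      rw [hg, map_add, map_smul, map_smul] at hm1
      have hex : ∃ a', α • a' - g (N.θ 1 m) = b ∧ β • a' + g (N.θ 0 m) = c := by
        by_cases hα : α = 0
        · subst hα
          have hβ : β ≠ 0 := by simpa using hab
          refine ⟨β⁻¹ • (c - g (N.θ 0 m)), ?_, by simp [smul_smul, hβ]⟩
          simp only [zero_smul, zero_add, zero_sub, ← smul_neg] at hm1 ⊢
          have := smul_right_injective A.carrier hβ hm1
          rw [this, neg_neg]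
        · refine ⟨α⁻¹ • (b + g (N.θ 1 m)), by simp [smul_smul, hα], ?_⟩
          apply smul_right_injective A.carrier hα
          change α • _ = α • _
          rw [smul_add, smul_comm α β, smul_smul α, mul_inv_cancel₀ hα, one_smul, smul_add]
          rw [eq_sub_iff_add_eq] at hm1
          rw [← hm1]; abel
      obtain ⟨a', ha1, ha2⟩ := hex
      refine ⟨p (itp A a'), ?_⟩
      rw [← act_hom hph, itp_apply, Fr_act]
      have hsum : q4 A 0 b c d = q4 A 0 (α • a') (β • a') (α • 0 - β • 0) + j m
          + j (i (d - g m)) := by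
        rw [hji, hja, q4_add, q4_add, q4_inj]
        simp [← ha1, ← ha2, sub_eq_add_neg]
      rw [hsum, map_add, map_add, hpj, hpj, add_zero, add_zero]
  refine ⟨L, ⟨⟨rel_of_surj hph hps (rel_Fr A), ?_, ?_, hdimL⟩, ?_⟩, (vcat_iff _).2 hE.rel,
    Fr A, p, j, ⟨Fr_projective A, hph, hps, ?_⟩, hj, hinj, hpk.symm⟩
  · intro l
    obtain ⟨q, rfl⟩ := hps l
    obtain ⟨a, b, c, d, rfl⟩ := q4_cases A q
    rw [← hp'.1, ← hp'.1, Fr_y, Fr_x, ← hji, hpj]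
  · intro a b hab
    rw [hrange a b hab, htk]
  · intro a b hab i m
    change L.θ i m ∈ LinearMap.range (act L a b)
    rw [hrange a b hab]
    fin_cases i
    · rw [← hrange 1 0 (by simp), act_one_zero]; exact ⟨m, rfl⟩
    · rw [← hrange 0 1 (by simp), act_zero_one]; exact ⟨m, rfl⟩
  · intro Q f hQ hf hsf
    apply surj_of_top hf
    intro w
    obtain ⟨m, hm⟩ := hsf (p (itp A w))
    refine ⟨m, ?_⟩
    have := hptp (f m - itp A w) (by rw [map_sub, ← hm]; simp)
    rw [map_sub, sub_eq_zero] at this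
    rw [this, itp_apply, tp_q4]

theorem negStep [IsAlgClosed k] [CharZero k] {r : ℕ} {N : GSupMod k (Fin 2)}
    (h : Neg (r + 1) N) : ∃ L, Neg r L ∧ IsCosyzygy (VCat k 2) L N := by
  have hrad := negRad h.1
  obtain ⟨hE, hk⟩ := h
  have hk0 : ∀ m, N.θ 0 m = 0 → ∀ i, N.θ i m = 0 := by
    intro m hm
    exact hk 1 0 (by simp) m (by rw [act_one_zero]; exact hm)
  obtain ⟨B, v, hv, hvr, hvp⟩ := exists_grsub N (LinearMap.ker (N.θ 0)) (by
    intro m hm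
    rw [LinearMap.mem_ker] at *
    rw [θ_pr, hm, map_zero, sub_zero])
  obtain ⟨g, hg, hgp⟩ := exists_retr B N v hv hvp
  obtain ⟨A, u, hu, hur, hup⟩ := exists_grsub N (LinearMap.ker g) (by
    intro m hm
    rw [LinearMap.mem_ker] at *
    rw [hgp, hm, map_zero])
  have hB : Module.finrank k B.carrier = r + 2 := by
    rw [← LinearMap.finrank_range_of_inj hv, hvr, ← act_one_zero, hE.ker 1 0 (by simp)]
  have hA : Module.finrank k A.carrier = r + 1 := by
    have h1 := g.finrank_range_add_finrank_ker
    rw [← hur, LinearMap.finrank_range_of_inj hu,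
      LinearMap.range_eq_top.2 (fun b => ⟨v b, hg b⟩), finrank_top, hB, hE.dim] at h1
    omega
  have hvk : ∀ b i, N.θ i (v b) = 0 := by
    intro b
    have : v b ∈ LinearMap.range v := ⟨b, rfl⟩
    rw [hvr] at this
    exact hk0 _ this
  have hdec : ∀ n, ∃ a b, n = u a + v b := by
    intro n
    have : n - v (g n) ∈ LinearMap.ker g := by simp [hg]
    rw [← hur] at this
    obtain ⟨a, ha⟩ := this
    exact ⟨a, g n, by rw [ha]; abel⟩
  have hu0 : ∀ a, N.θ 0 (u a) = 0 → a = 0 := by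
    intro a ha
    have h1 : u a ∈ LinearMap.range v := by rw [hvr]; exact ha
    obtain ⟨b, hb⟩ := h1
    have h2 : u a ∈ LinearMap.range u := ⟨a, rfl⟩
    rw [hur, LinearMap.mem_ker, ← hb, hg] at h2
    rw [h2, map_zero] at hb
    exact (map_eq_zero_iff u hu).1 hb.symm
  have hπ := ind_hom A N hE.rel u hup
  set π := ind A N u with hπd
  have hπa : ∀ a b c d, π (q4 A a b c d) = u a + N.θ 0 (u b) + N.θ 1 (u c) := by
    intro a b c d
    rw [hπd, ind_apply, hE.xy, add_zero]
  have hπs : Function.Surjective π := by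
    intro n
    obtain ⟨a, z, rfl⟩ := hdec n
    obtain ⟨b', c', hz⟩ := hrad (v z) (hvk z 0) (hvk z 1)
    obtain ⟨b, zb, rfl⟩ := hdec b'
    obtain ⟨c, zc, rfl⟩ := hdec c'
    refine ⟨q4 A a b c 0, ?_⟩
    rw [hπa, hz]
    simp [hvk, add_assoc]
  have hπ' := (isHom_iff _ _ _).1 hπ
  obtain ⟨L, i, hi, hir, hih⟩ := exists_sub (Fr A) (LinearMap.ker π)
    (by intro m hm; rw [LinearMap.mem_ker] at *; rw [hπ'.2, hm, map_zero])
    (by intro i m hm; rw [LinearMap.mem_ker] at *; rw [hπ'.1, hm, map_zero])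
  have hi' := (isHom_iff _ _ _).1 hih
  have hL : ∀ l, ∃ b c d, i l = q4 A 0 b c d ∧ N.θ 0 (u b) + N.θ 1 (u c) = 0 := by
    intro l
    obtain ⟨a, b, c, d, hq⟩ := q4_cases A (i l)
    have h1 : i l ∈ LinearMap.range i := ⟨l, rfl⟩
    rw [hir, LinearMap.mem_ker, hq, hπa] at h1
    have h2 := congrArg (N.θ 0) h1
    simp only [map_add, hE.zz, add_zero, map_zero] at h2
    have := hu0 a h2
    subst this
    exact ⟨b, c, d, hq, by simpa using h1⟩
  have hsocL : ∀ d, ∃ l, i l = q4 A 0 0 0 d := by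
    intro d
    change _ ∈ LinearMap.range i
    rw [hir, LinearMap.mem_ker, hπa]; simp
  have hdimL : Module.finrank k L.carrier = 2 * r + 1 := by
    have h1 := π.finrank_range_add_finrank_ker
    rw [← hir, LinearMap.finrank_range_of_inj hi, LinearMap.range_eq_top.2 hπs, finrank_top,
      finrank_Fr, hA, hE.dim] at h1
    omega
  have hker : ∀ α β : k, (α ≠ 0 ∨ β ≠ 0) → ∀ l, act L α β l = 0 → ∃ d, i l = q4 A 0 0 0 d := by
    intro α β hab l hl
    obtain ⟨b, c, d, hq, hbc⟩ := hL l
    have h1 := congrArg i hl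
    rw [act_hom hih, hq, Fr_act, map_zero, q4_zero, q4_inj] at h1
    have h2 := sub_eq_zero.1 h1.2.2.2
    have hex : ∃ e, b = α • e ∧ c = β • e := by
      by_cases hα : α = 0
      · subst hα
        have hβ : β ≠ 0 := by simpa using hab
        refine ⟨β⁻¹ • c, ?_, by simp [smul_smul, hβ]⟩
        rw [zero_smul] at h2 ⊢
        exact (smul_eq_zero.1 h2.symm).resolve_left hβ
      · refine ⟨α⁻¹ • b, by simp [smul_smul, hα], ?_⟩
        rw [smul_comm, ← h2, smul_smul, inv_mul_cancel₀ hα, one_smul]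
    obtain ⟨e, rfl, rfl⟩ := hex
    have h3 : act N α β (u e) = 0 := by
      rw [act_apply]; simpa using hbc
    have := hu0 e (hk α β hab _ h3 0)
    subst this
    exact ⟨d, by simpa using hq⟩
  have hkL : ∀ α β : k, (α ≠ 0 ∨ β ≠ 0) → ∀ l, act L α β l = 0 → ∀ j, L.θ j l = 0 := by
    intro α β hab l hl j
    obtain ⟨d, hd⟩ := hker α β hab l hl
    apply hi
    rw [hi'.1, hd, map_zero]
    fin_cases j
    · exact (Fr_x A 0 0 0 d).trans (q4_zero A).symm
    · exact (Fr_y A 0 0 0 d).trans (by rw [neg_zero, q4_zero])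
  have hsoinj : Function.Injective (iso A) := by
    intro a b hab
    rw [iso_apply, iso_apply, q4_inj] at hab
    exact hab.2.2.2
  have hkd : ∀ α β : k, (α ≠ 0 ∨ β ≠ 0) →
      Module.finrank k (LinearMap.ker (act L α β)) = r + 1 := by
    intro α β hab
    have : (LinearMap.ker (act L α β)).map i = LinearMap.range (iso A) := by
      ext q
      constructor
      · rintro ⟨l, hl, rfl⟩
        obtain ⟨d, hd⟩ := hker α β hab l hl
        exact ⟨d, by rw [hd, iso_apply]⟩
      · rintro ⟨d, rfl⟩
        obtain ⟨l, hl⟩ := hsocL d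
        refine ⟨l, ?_, hl⟩
        change act L α β l = 0
        apply hi
        rw [act_hom hih, hl, Fr_act, map_zero, q4_zero]
        simp
    rw [(Submodule.equivMapOfInjective i hi _).finrank_eq, this,
      LinearMap.finrank_range_of_inj hsoinj, hA]
  refine ⟨L, ⟨⟨rel_of_inj hih hi (rel_Fr A), ?_, ?_, hdimL⟩, hkL⟩, (vcat_iff _).2 hE.rel,
    Fr A, i, π, ⟨Fr_injective A, hih, hi, ?_⟩, hπ, hπs, hir.symm⟩
  · intro l
    apply hi
    obtain ⟨b, c, d, hq, -⟩ := hL l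
    rw [hi'.1, hi'.1, hq, Fr_y, Fr_x, map_zero, q4_zero]
  · intro α β hab
    have := (act L α β).finrank_range_add_finrank_ker
    rw [hkd α β hab, hdimL] at this
    omega
  · intro Q f hQ hf hfi
    have hf' := ((isHom_iff _ _ _).1 hf).1
    have h4 : ∀ d, f (q4 A 0 0 0 d) = 0 → d = 0 := by
      intro d hd
      obtain ⟨l, hl⟩ := hsocL d
      have : l = 0 := by
        apply hfi
        rw [LinearMap.comp_apply, hl, hd, map_zero]
      rw [this, map_zero, q4_zero, q4_inj] at hl
      exact hl.2.2.2.symm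
    rw [injective_iff_map_eq_zero]
    intro q hq
    obtain ⟨a, b, c, d, rfl⟩ := q4_cases A q
    have ha : a = 0 := by
      apply h4
      have e : q4 A 0 0 0 a = (Fr A).θ 0 ((Fr A).θ 1 (q4 A a b c d)) := by rw [Fr_y, Fr_x]
      rw [e, hf', hf', hq, map_zero, map_zero]
    subst ha
    have hc : c = 0 := by
      apply h4
      rw [← Fr_x A 0 b c d, hf', hq, map_zero]
    have hb : b = 0 := by
      rw [← neg_eq_zero]
      apply h4
      rw [← Fr_y A 0 b c d, hf', hq, map_zero]
    subst hc hb
    rw [h4 d hq, q4_zero]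

theorem base [CharZero k] {N : GSupMod k (Fin 2)} (h : EE 0 N) :
    ∃ p, IsTrivial p N ∧ IsOmegaZero (VCat k 2) N N := by
  have hd : Module.finrank k N.carrier = 1 := by simpa using h.dim
  have hθ : ∀ i, N.θ i = 0 := by
    intro i
    fin_cases i
    · have := h.rk 1 0 (by simp)
      rw [act_one_zero, Submodule.finrank_eq_zero] at this
      exact LinearMap.range_eq_bot.1 this
    · have := h.rk 0 1 (by simp)
      rw [act_zero_one, Submodule.finrank_eq_zero] at this
      exact LinearMap.range_eq_bot.1 this
  have hO : IsOmegaZero (VCat k 2) N N := by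
    let Z : GSupMod k (Fin 2) := mkG PUnit 0 (by simp) 0 (by simp)
    have hZ : ∀ z : Z.carrier, z = 0 := fun z => rfl
    refine ⟨Z, ⟨fun i j => LinearMap.ext fun m => hZ _, ?_⟩, ?_, ?_⟩
    · intro M N π f _ _ _ _ _
      refine ⟨0, (isHom_iff _ _ _).2 ⟨by simp, by simp⟩, LinearMap.ext fun z => ?_⟩
      rw [hZ z]; simp
    · rintro A B hA ⟨φ, -, -, hφ⟩ a
      have hz : ∀ a, A.θ 0 a = 0 := by
        intro a
        have := hφ 0 (φ.symm (a, 0))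
        rw [hθ] at this
        simp only [LinearMap.zero_apply, map_zero, LinearEquiv.apply_symm_apply] at this
        exact (Prod.ext_iff.1 this).1.symm
      obtain ⟨q, hq⟩ := proj_exact A hA 1 0 (by simp) a (by rw [act_one_zero, hz])
      rw [← hq, act_one_zero, hz]
    · refine dsum_of LinearMap.id 0 ((isHom_iff _ _ _).2 ⟨fun _ _ => rfl, fun _ => rfl⟩)
        ((isHom_iff _ _ _).2 ⟨by simp, by simp⟩) ⟨?_, fun n => ⟨(n, 0), by simp⟩⟩
      rintro ⟨n, z⟩ ⟨n', z'⟩ hn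
      have : n = n' := by simpa using hn
      rw [this, hZ z, hZ z']
  by_cases he : N.ev = ⊥
  · refine ⟨true, ⟨hd, hθ, ?_⟩, hO⟩
    have := N.isCompl.sup_eq_top
    rw [he, bot_sup_eq] at this
    simpa using this
  · refine ⟨false, ⟨hd, hθ, ?_⟩, hO⟩
    have h1 : Module.finrank k N.ev ≠ 0 := fun h => he (Submodule.finrank_eq_zero.1 h)
    simpa using Submodule.eq_top_of_finrank_eq (le_antisymm (Submodule.finrank_le _) (by omega))

theorem posAll [IsAlgClosed k] [CharZero k] (r : ℕ) : ∀ N : GSupMod k (Fin 2), Pos r N →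
    ∃ p K, IsTrivial p K ∧ IsOmegaPow (VCat k 2) r K N := by
  induction r with
  | zero =>
    intro N h
    obtain ⟨p, h1, h2⟩ := base h.1
    exact ⟨p, N, h1, h2⟩
  | succ r ih =>
    intro N h
    obtain ⟨L, hL, hs⟩ := posStep h
    obtain ⟨p, K, h1, h2⟩ := ih L hL
    exact ⟨p, K, h1, L, h2, hs⟩

theorem negAll [IsAlgClosed k] [CharZero k] (r : ℕ) : ∀ N : GSupMod k (Fin 2), Neg r N →
    ∃ p K, IsTrivial p K ∧ IsOmegaNegPow (VCat k 2) r K N := by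
  induction r with
  | zero =>
    intro N h
    obtain ⟨p, h1, h2⟩ := base h.1
    exact ⟨p, N, h1, h2⟩
  | succ r ih =>
    intro N h
    obtain ⟨L, hL, hs⟩ := negStep h
    obtain ⟨p, K, h1, h2⟩ := ih L hL
    exact ⟨p, K, h1, L, h2, hs⟩

theorem main [IsAlgClosed k] [CharZero k] (M : GSupMod k (Fin 2)) (hM : VCat k 2 M)
    (hE : IsEndotrivial (VCat k 2) M) :
    ∃ (n : ℤ) (p : Bool) (K N P : GSupMod k (Fin 2)),
      IsTrivial p K ∧ IsOmega (VCat k 2) n K N ∧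
      IsProjective (VCat k 2) P ∧ IsDsum N P M := by
  obtain ⟨N, W, hD, hN, hxy⟩ := strip M ((vcat_iff _).1 hM)
  have hodd : ∀ a b : k, (a ≠ 0 ∨ b ≠ 0) → Module.finrank k N.carrier =
      2 * Module.finrank k (LinearMap.range (act N a b)) + 1 := by
    intro a b hab
    have h1 := endo_rank M hE a b hab
    have h2 := exact_rank (rel_Fr W) a b (Fr_exact W a b hab)
    rw [dsum_finrank hD, dsum_rank hD] at h1
    omega
  have h10 := hodd 1 0 (by simp)
  set r := Module.finrank k (LinearMap.range (act N 1 0)) with hr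
  have hEE : EE r N := ⟨hN, hxy, fun a b hab => by have := hodd a b hab; omega, h10⟩
  rcases dich hEE with hp | ⟨hn, -⟩
  · obtain ⟨p, K, h1, h2⟩ := posAll r N hp
    refine ⟨r, p, K, N, Fr W, h1, ?_, Fr_projective W, hD⟩
    simpa [IsOmega] using h2
  · obtain ⟨p, K, h1, h2⟩ := negAll r N hn
    refine ⟨-r, p, K, N, Fr W, h1, ?_, Fr_projective W, hD⟩
    by_cases h0 : r = 0
    · rw [h0] at h2 ⊢
      simpa [IsOmega, IsOmegaPow, IsOmegaNegPow] using h2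
    · rw [IsOmega, if_neg (by omega)]
      simpa using h2

end Aux

end SupCat

open SupCat SupCat.GSupMod in
/-- Let `M` be an endotrivial `V(a₂)`-supermodule in `F`,
where `a₂` is a rank `2` detecting subalgebra (so `V(a₂) = Λ((a₂)₁)` is the
exterior superalgebra on a two-dimensional purely odd space).  Then
`M ≅ Ωⁿ(k) ⊕ P` for some integer `n`, where `k` is either the trivial module
`k_ev` or its parity shift `k_od`, and `P` is a projective module in `F`. -/
theorem endotrivial_Va2_is_syzygy_of_trivial
    (k : Type) [Field k] [IsAlgClosed k] [CharZero k]
    (M : GSupMod k (Fin 2)) (hM : VCat k 2 M)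
    (hE : IsEndotrivial (VCat k 2) M) :
    ∃ (n : ℤ) (p : Bool) (K N P : GSupMod k (Fin 2)),
      IsTrivial p K ∧ IsOmega (VCat k 2) n K N ∧
      IsProjective (VCat k 2) P ∧ IsDsum N P M := by
  exact SupCat.Aux.main M hM hE
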